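/- Let -1 < v < 0. Then Q_v is a proper subset of (0,1): there exists q ∈ (0,1) and x ∈ ℝ_q^+ such that the q-translation operator T_{q,x}^v is not positive (equivalently, D_v(1,q^i,1) < 0 for some integer i ≥ 0 and some q ∈ (0,1)). -/

import Mathlib

open scoped BigOperators

noncomputable section

/-- Finite q-Pochhammer symbol `(a;q)_n = ∏_{i=0}^{n-1} (1 - a q^i)`. -/
def qPoch (a q : ℝ) (n : ℕ) : ℝ := ∏ i ∈ Finset.range n, (1 - a * q ^ i)

/-- Infinite q-Pochhammer symbol `(a;q)_∞ = ∏_{i=0}^{∞} (1 - a q^i)`. -/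
def qPochInf (a q : ℝ) : ℝ := ∏' i : ℕ, (1 - a * q ^ i)

/-- Normalized Hahn–Exton q-Bessel function `j_v(x,q²)`. -/
def jHE (q v x : ℝ) : ℝ :=
  ∑' n : ℕ, (-1 : ℝ) ^ n * q ^ (n * (n + 1)) * x ^ (2 * n) /
    (qPoch (q ^ 2) (q ^ 2) n * qPoch (q ^ (2 * v + 2)) (q ^ 2) n)

/-- Hahn–Exton q-Bessel function with base `p`:
`J_v(x,p) = (x^v/(p;p)_∞) Σ_{n} (-1)^n p^{n(n+1)/2} (p^{v+n+1};p)_∞ x^{2n}/(p;p)_n`.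
With `p = q²` this is `J_v(x,q²)`. -/
def JHE (p v x : ℝ) : ℝ :=
  (x ^ v / qPochInf p p) *
    ∑' n : ℕ, (-1 : ℝ) ^ n * p ^ (((n : ℝ) * ((n : ℝ) + 1)) / 2) *
      qPochInf (p ^ (v + (n : ℝ) + 1)) p * x ^ (2 * n) / qPoch p p n

/-- The constant `c_{q,v}`. -/
def cqv (q v : ℝ) : ℝ :=
  (1 / (1 - q)) * qPochInf (q ^ (2 * v + 2)) (q ^ 2) / qPochInf (q ^ 2) (q ^ 2)

/-- Jackson q-integral on `[0,∞)`: `∫_0^∞ f(x) d_q x = (1-q) Σ_{n∈ℤ} q^n f(q^n)`. -/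
def jackson (q : ℝ) (f : ℝ → ℝ) : ℝ := (1 - q) * ∑' n : ℤ, q ^ n * f (q ^ n)

/-- The q-lattice `ℝ_q^+ = {q^n : n ∈ ℤ}`. -/
def Rq (q : ℝ) : Set ℝ := {x | ∃ n : ℤ, x = q ^ n}

/-- Membership in `L_{q,1,v}`: the Jackson integral `∫_0^∞ |f(x)| x^{2v+1} d_q x`
converges (absolutely). -/
def memL1 (q v : ℝ) (f : ℝ → ℝ) : Prop :=
  Summable fun n : ℤ => q ^ n * |f (q ^ n)| * (q ^ n) ^ (2 * v + 1 : ℝ)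

/-- q-Bessel Fourier transform `F_{q,v}`. -/
def qFourier (q v : ℝ) (f : ℝ → ℝ) (x : ℝ) : ℝ :=
  cqv q v * jackson q fun t => f t * jHE q v (x * t) * t ^ (2 * v + 1 : ℝ)

/-- q-translation operator `T_{q,x}^v`. -/
def qTrans (q v x : ℝ) (f : ℝ → ℝ) (y : ℝ) : ℝ :=
  cqv q v * jackson q fun t =>
    qFourier q v f t * jHE q v (x * t) * jHE q v (y * t) * t ^ (2 * v + 1 : ℝ)

/-- The kernel `D_v(x,y,z)`. -/
def Dker (q v x y z : ℝ) : ℝ :=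
  (cqv q v) ^ 2 * jackson q fun t =>
    jHE q v (x * t) * jHE q v (y * t) * jHE q v (z * t) * t ^ (2 * v + 1 : ℝ)

/-- Positivity of the q-translation operator `T_{q,x}^v`. -/
def IsPosT (q v x : ℝ) : Prop :=
  ∀ f : ℝ → ℝ, memL1 q v f → (∀ y ∈ Rq q, 0 ≤ f y) → ∀ y ∈ Rq q, 0 ≤ qTrans q v x f y

/-- The positivity domain `Q_v`. -/
def Qset (v : ℝ) : Set ℝ :=
  {q | q ∈ Set.Ioo (0 : ℝ) 1 ∧ ∀ x ∈ Rq q, IsPosT q v x}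

/-- The kernel `E_{v,x}(q^m,q^z,q^k)`. -/
def Ekern (q v x : ℝ) (m z k : ℤ) : ℝ :=
  (1 / ((1 - q) ^ 2 * cqv q v * cqv q (x - v))) *
    q ^ (-(k : ℝ) * (x + 2) - (m : ℝ) * v - (z : ℝ) * (x - v)) *
    JHE (q ^ 2) ((z : ℝ) - (k : ℝ)) (q ^ (x - v + (m : ℝ) - (k : ℝ))) *
    JHE (q ^ 2) (v + (z : ℝ) - (k : ℝ)) (q ^ ((m : ℝ) - (k : ℝ)))

/-- The function `q ↦ ₁φ₁(0;q;q,q) = Σ_{n} (-1)^n q^{n(n+1)/2} q^n /((q;q)_n)²`. -/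
def phiQ (q : ℝ) : ℝ :=
  ∑' n : ℕ, (-1 : ℝ) ^ n * q ^ (((n : ℝ) * ((n : ℝ) + 1)) / 2) * q ^ n / (qPoch q q n) ^ 2

/-- The coefficients `(-1)^k p^{k(k-1)/2} / (p;p)_k` of Euler's expansion of `(z;p)_∞`. -/
def eulerCoeff (p : ℝ) (k : ℕ) : ℝ := ∏ i ∈ Finset.range k, (-(p ^ i) / (1 - p ^ (i + 1)))

/-- Euler's entire function `∑ (-1)^k p^{k(k-1)/2} z^k / (p;p)_k`, that is `(z;p)_∞`. -/
def eulerFun (p z : ℝ) : ℝ := ∑' k : ℕ, eulerCoeff p k * z ^ k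

/-- `eulerCoeff` extended by zero to the negative integers. -/
def eulerCoeffInt (p : ℝ) (m : ℤ) : ℝ := if m < 0 then 0 else eulerCoeff p m.toNat

/-- The value `(p^{m+1};p)_∞` for an integer `m`. -/
def eulerTheta (p : ℝ) (m : ℤ) : ℝ := eulerFun p (p ^ (m + 1))

/-- The Hahn–Exton function at the lattice point `n`, up to normalization. -/
def besselLattice (p a : ℝ) (n : ℤ) : ℝ :=
  ∑' k : ℤ, eulerCoeffInt p k * a ^ k * eulerTheta p (n + k)

section Euler

variable {p : ℝ}

lemma one_sub_pow_succ_pos (hp0 : 0 < p) (hp1 : p < 1) (k : ℕ) : 0 < 1 - p ^ (k + 1) :=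
  sub_pos.2 (pow_lt_one₀ hp0.le hp1 (Nat.succ_ne_zero k))

lemma eulerCoeff_succ (p : ℝ) (k : ℕ) :
    eulerCoeff p (k + 1) = eulerCoeff p k * (-(p ^ k) / (1 - p ^ (k + 1))) :=
  Finset.prod_range_succ _ _

lemma eulerCoeff_zero (p : ℝ) : eulerCoeff p 0 = 1 := Finset.prod_range_zero _

lemma eulerCoeff_succ_mul (hp0 : 0 < p) (hp1 : p < 1) (k : ℕ) :
    eulerCoeff p (k + 1) * (1 - p ^ (k + 1)) = -(p ^ k) * eulerCoeff p k := by
  have := (one_sub_pow_succ_pos hp0 hp1 k).ne'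
  rw [eulerCoeff_succ]
  field_simp

lemma summable_eulerCoeff (hp0 : 0 < p) (hp1 : p < 1) {z : ℝ} (hz : 0 ≤ z) :
    Summable fun k : ℕ => |eulerCoeff p k| * z ^ k := by
  have ht : Filter.Tendsto (fun k : ℕ => p ^ k * z / (1 - p)) Filter.atTop (nhds 0) := by
    have := ((tendsto_pow_atTop_nhds_zero_of_lt_one hp0.le hp1).mul_const z).div_const (1 - p)
    simpa using this
  refine summable_of_ratio_norm_eventually_le (r := 1 / 2) (by norm_num) ?_
  filter_upwards [ht.eventually (gt_mem_nhds (by norm_num : (0 : ℝ) < 1 / 2))] with k hk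
  have h1 := one_sub_pow_succ_pos hp0 hp1 k
  have h2 : p ^ (k + 1) ≤ p := pow_le_of_le_one hp0.le hp1.le (Nat.succ_ne_zero k)
  have h3 : p ^ k * z / (1 - p ^ (k + 1)) ≤ 1 / 2 := by
    refine le_trans ?_ hk.le
    have : 0 < 1 - p := by linarith
    gcongr
  rw [eulerCoeff_succ, abs_mul, abs_div, abs_neg, abs_of_pos h1, abs_of_pos (pow_pos hp0 k)]
  rw [Real.norm_of_nonneg (by positivity), Real.norm_of_nonneg (by positivity)]
  calc |eulerCoeff p k| * (p ^ k / (1 - p ^ (k + 1))) * z ^ (k + 1)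
      = (p ^ k * z / (1 - p ^ (k + 1))) * (|eulerCoeff p k| * z ^ k) := by ring
    _ ≤ _ := by gcongr

lemma summable_eulerFun (hp0 : 0 < p) (hp1 : p < 1) {z : ℝ} (hz : 0 ≤ z) :
    Summable fun k : ℕ => eulerCoeff p k * z ^ k := by
  refine Summable.of_norm ?_
  simpa [abs_mul, abs_of_nonneg hz] using summable_eulerCoeff hp0 hp1 hz

lemma eulerFun_eq (hp0 : 0 < p) (hp1 : p < 1) {z : ℝ} (hz : 0 ≤ z) :
    eulerFun p z = (1 - z) * eulerFun p (p * z) := by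
  have h1 := summable_eulerFun hp0 hp1 hz
  have h2 := summable_eulerFun hp0 hp1 (mul_nonneg hp0.le hz)
  have e : eulerFun p z - eulerFun p (p * z) = -z * eulerFun p (p * z) := by
    unfold eulerFun
    rw [← h1.tsum_sub h2, (h1.sub h2).tsum_eq_zero_add, ← tsum_mul_left]
    simp only [pow_zero, sub_self, zero_add]
    refine tsum_congr fun k => ?_
    have := eulerCoeff_succ_mul hp0 hp1 k
    simp only [mul_pow]
    linear_combination z ^ (k + 1) * this
  linear_combination e

lemma eulerFun_eq_qPoch (hp0 : 0 < p) (hp1 : p < 1) {z : ℝ} (hz : 0 ≤ z) (n : ℕ) :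
    eulerFun p z = qPoch z p n * eulerFun p (z * p ^ n) := by
  induction n with
  | zero => simp [qPoch]
  | succ n ih =>
    rw [ih, eulerFun_eq hp0 hp1 (z := z * p ^ n) (by positivity), qPoch, qPoch,
      Finset.prod_range_succ, pow_succ]
    ring_nf

lemma abs_eulerFun_le (hp0 : 0 < p) (hp1 : p < 1) {z : ℝ} (hz : 0 ≤ z) (hz1 : z ≤ 1) :
    |eulerFun p z| ≤ ∑' k : ℕ, |eulerCoeff p k| := by
  have h := summable_eulerCoeff hp0 hp1 zero_le_one
  simp only [one_pow, mul_one] at h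
  rw [← Real.norm_eq_abs]
  refine tsum_of_norm_bounded h.hasSum fun k => ?_
  rw [norm_mul, norm_pow, Real.norm_eq_abs, Real.norm_of_nonneg hz]
  exact mul_le_of_le_one_right (abs_nonneg _) (pow_le_one₀ hz hz1)

lemma qPoch_pos (hp0 : 0 < p) (hp1 : p < 1) {z : ℝ} (hz : 0 ≤ z) (hz1 : z < 1) (n : ℕ) :
    0 < qPoch z p n := by
  refine Finset.prod_pos fun i _ => sub_pos.2 ?_
  calc z * p ^ i ≤ z * 1 := by gcongr; exact pow_le_one₀ hp0.le hp1.le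
    _ < 1 := by linarith

lemma eulerFun_pos (hp0 : 0 < p) (hp1 : p < 1) {z : ℝ} (hz : 0 ≤ z) (hz1 : z < 1) :
    0 < eulerFun p z := by
  have hs := summable_eulerCoeff hp0 hp1 zero_le_one
  simp only [one_pow, mul_one] at hs
  have hs' := (summable_nat_add_iff 1).2 hs
  set M := ∑' k : ℕ, |eulerCoeff p (k + 1)| with hM
  have hM0 : 0 ≤ M := tsum_nonneg fun _ => abs_nonneg _
  have key : ∀ y : ℝ, 0 ≤ y → y ≤ 1 → 1 - y * M ≤ eulerFun p y := by
    intro y hy hy1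
    have h1 := summable_eulerFun hp0 hp1 hy
    have : |∑' k : ℕ, eulerCoeff p (k + 1) * y ^ (k + 1)| ≤ y * M := by
      rw [← Real.norm_eq_abs]
      refine tsum_of_norm_bounded (hs'.hasSum.mul_left y) fun k => ?_
      rw [norm_mul, norm_pow, Real.norm_eq_abs, Real.norm_of_nonneg hy, pow_succ]
      have : y ^ k ≤ 1 := pow_le_one₀ hy hy1
      have h3 : 0 ≤ |eulerCoeff p (k + 1)| * y := by positivity
      nlinarith
    rw [eulerFun, h1.tsum_eq_zero_add]
    simp only [eulerCoeff_zero, pow_zero, mul_one]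
    linarith [neg_le_of_abs_le this]
  have ht : Filter.Tendsto (fun n : ℕ => z * p ^ n * M) Filter.atTop (nhds 0) := by
    simpa using ((tendsto_pow_atTop_nhds_zero_of_lt_one hp0.le hp1).const_mul z).mul_const M
  obtain ⟨n, hn⟩ := (ht.eventually (gt_mem_nhds one_pos)).exists
  rw [eulerFun_eq_qPoch hp0 hp1 hz n]
  have hle : z * p ^ n ≤ 1 := mul_le_one₀ hz1.le (by positivity) (pow_le_one₀ hp0.le hp1.le)
  have := key (z * p ^ n) (by positivity) hle
  exact mul_pos (qPoch_pos hp0 hp1 hz hz1 n) (by linarith)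

lemma eulerTheta_pred (hp0 : 0 < p) (hp1 : p < 1) (m : ℤ) :
    eulerTheta p (m - 1) = (1 - p ^ m) * eulerTheta p m := by
  have h := eulerFun_eq hp0 hp1 (z := p ^ m) (by positivity)
  rw [eulerTheta, eulerTheta, sub_add_cancel, h, zpow_add_one₀ hp0.ne', mul_comm p]

lemma eulerTheta_of_neg (hp0 : 0 < p) (hp1 : p < 1) {m : ℤ} (hm : m < 0) :
    eulerTheta p m = 0 := by
  obtain ⟨k, rfl⟩ : ∃ k : ℕ, m = -1 - k := ⟨(-1 - m).toNat, by omega⟩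
  clear hm
  induction k with
  | zero => simpa using eulerTheta_pred hp0 hp1 0
  | succ k ih =>
    have := eulerTheta_pred hp0 hp1 (-1 - k)
    rw [ih, mul_zero] at this
    rw [← this]
    congr 1
    push_cast
    ring

lemma abs_eulerTheta_le (hp0 : 0 < p) (hp1 : p < 1) (m : ℤ) :
    |eulerTheta p m| ≤ ∑' k : ℕ, |eulerCoeff p k| := by
  rcases lt_or_ge m 0 with hm | hm
  · rw [eulerTheta_of_neg hp0 hp1 hm, abs_zero]
    exact tsum_nonneg fun _ => abs_nonneg _
  · refine abs_eulerFun_le hp0 hp1 (by positivity) ?_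
    exact zpow_le_one₀ hp0 hp1.le (by omega)

lemma eulerCoeffInt_of_neg (p : ℝ) {m : ℤ} (hm : m < 0) : eulerCoeffInt p m = 0 := if_pos hm

lemma eulerCoeffInt_natCast (p : ℝ) (k : ℕ) : eulerCoeffInt p k = eulerCoeff p k := by
  simp [eulerCoeffInt]

lemma eulerCoeffInt_zero (p : ℝ) : eulerCoeffInt p 0 = 1 := by
  simp [eulerCoeffInt, eulerCoeff_zero]

lemma eulerCoeffInt_mul (hp0 : 0 < p) (hp1 : p < 1) (m : ℤ) :
    eulerCoeffInt p m * (1 - p ^ m) = -(p ^ (m - 1)) * eulerCoeffInt p (m - 1) := by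
  rcases lt_trichotomy m 0 with hm | rfl | hm
  · rw [eulerCoeffInt_of_neg p hm, eulerCoeffInt_of_neg p (by omega)]; simp
  · rw [eulerCoeffInt_of_neg p (m := 0 - 1) (by omega)]; simp
  · obtain ⟨k, rfl⟩ : ∃ k : ℕ, m = (k + 1 : ℕ) := ⟨(m - 1).toNat, by omega⟩
    have h := eulerCoeff_succ_mul hp0 hp1 k
    have e : ((k + 1 : ℕ) : ℤ) - 1 = k := by push_cast; ring
    rw [e, eulerCoeffInt_natCast, eulerCoeffInt_natCast, zpow_natCast, zpow_natCast, h]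

lemma support_int_subset_range {f : ℤ → ℝ} (h : ∀ m < 0, f m = 0) :
    Function.support f ⊆ Set.range ((↑) : ℕ → ℤ) := by
  intro m hm
  rcases lt_or_ge m 0 with h' | h'
  · exact absurd (h m h') hm
  · exact ⟨m.toNat, by simp [h']⟩

lemma tsum_int_eq_tsum_nat {f : ℤ → ℝ} (h : ∀ m < 0, f m = 0) :
    ∑' m : ℤ, f m = ∑' k : ℕ, f k :=
  (Nat.cast_injective.tsum_eq (support_int_subset_range h)).symm

lemma summable_int_iff_summable_nat {f : ℤ → ℝ} (h : ∀ m < 0, f m = 0) :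
    Summable f ↔ Summable fun k : ℕ => f k :=
  (Nat.cast_injective.summable_iff fun _ hx =>
    Function.notMem_support.1 fun hs => hx (support_int_subset_range h hs)).symm

lemma summable_eulerCoeffInt (hp0 : 0 < p) (hp1 : p < 1) {z : ℝ} (hz : 0 ≤ z) :
    Summable fun m : ℤ => |eulerCoeffInt p m| * z ^ m := by
  rw [summable_int_iff_summable_nat fun m hm => by simp [eulerCoeffInt_of_neg p hm]]
  simpa [eulerCoeffInt_natCast] using summable_eulerCoeff hp0 hp1 hz

end Euler

section Vandermonde

variable {p : ℝ}

lemma summable_eulerCoeffInt_mul_bounded (hp0 : 0 < p) (hp1 : p < 1) {z : ℝ} (hz : 0 ≤ z)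
    {f : ℤ → ℝ} {C : ℝ} (hf : ∀ m, |f m| ≤ C) :
    Summable fun m : ℤ => eulerCoeffInt p m * z ^ m * f m := by
  refine Summable.of_norm_bounded ((summable_eulerCoeffInt hp0 hp1 hz).mul_right C) fun m => ?_
  rw [norm_mul, norm_mul, norm_zpow, Real.norm_of_nonneg hz]
  exact mul_le_mul_of_nonneg_left (hf m) (by positivity)

lemma abs_eulerTheta_mul_le (hp0 : 0 < p) (hp1 : p < 1) (m n : ℤ) :
    |eulerTheta p m * eulerTheta p n| ≤ (∑' k : ℕ, |eulerCoeff p k|) ^ 2 := by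
  rw [abs_mul, sq]
  exact mul_le_mul (abs_eulerTheta_le hp0 hp1 m) (abs_eulerTheta_le hp0 hp1 n) (abs_nonneg _)
    (tsum_nonneg fun _ => abs_nonneg _)

lemma tsum_eulerCoeffInt_mul_eulerTheta (hp0 : 0 < p) (hp1 : p < 1) (N K : ℤ) :
    ∑' i : ℤ, eulerCoeffInt p i * eulerTheta p (N - i) * eulerTheta p (K - i) =
      p ^ (N * K) * eulerTheta p N * eulerTheta p K := by
  rcases lt_or_ge N 0 with hN | hN
  · rw [eulerTheta_of_neg hp0 hp1 hN, mul_zero, zero_mul, ← tsum_zero]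
    refine tsum_congr fun i => ?_
    rcases lt_or_ge i 0 with hi | hi
    · simp [eulerCoeffInt_of_neg p hi]
    · simp [eulerTheta_of_neg hp0 hp1 (show N - i < 0 by omega)]
  obtain ⟨n, rfl⟩ := Int.eq_ofNat_of_zero_le hN
  clear hN
  induction n with
  | zero =>
    rw [tsum_eq_single 0]
    · simp [eulerCoeffInt_zero]
    · intro i hi
      rcases lt_or_gt_of_ne hi with hi | hi
      · simp [eulerCoeffInt_of_neg p hi]
      · simp [eulerTheta_of_neg hp0 hp1 (show -i < 0 by omega)]
  | succ n ih =>
    have hsum : ∀ (z : ℝ), 0 ≤ z → ∀ A B : ℤ, Summable fun i : ℤ =>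
        eulerCoeffInt p i * z ^ i * (eulerTheta p (A - i) * eulerTheta p (B - i)) :=
      fun z hz A B => summable_eulerCoeffInt_mul_bounded hp0 hp1 hz
        fun i => abs_eulerTheta_mul_le hp0 hp1 (A - i) (B - i)
    have h1 := hsum 1 zero_le_one (n + 1) K
    have h2 := hsum p hp0.le (n + 1) K
    have h3 := hsum p hp0.le n K
    have h4 := hsum p hp0.le n (K - 1)
    simp only [one_zpow, mul_one] at h1
    have hne : (1 - p ^ (n + 1)) ≠ 0 := (one_sub_pow_succ_pos hp0 hp1 n).ne'
    have hth : eulerTheta p n = (1 - p ^ (n + 1)) * eulerTheta p (n + 1 : ℤ) := by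
      have := eulerTheta_pred hp0 hp1 (n + 1 : ℤ)
      rw [add_sub_cancel_right] at this
      rw [this]; norm_cast
    refine mul_left_cancel₀ hne ?_
    have hshift : ∑' i : ℤ, eulerCoeffInt p i * (1 - p ^ i) *
          (eulerTheta p (n + 1 - i) * eulerTheta p (K - i)) =
        -∑' i : ℤ, eulerCoeffInt p i * p ^ i *
          (eulerTheta p (n - i) * eulerTheta p (K - 1 - i)) := by
      rw [← (Equiv.addRight (1 : ℤ)).tsum_eq, ← tsum_neg]
      refine tsum_congr fun i => ?_
      simp only [Equiv.coe_addRight]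
      rw [eulerCoeffInt_mul hp0 hp1]
      simp only [add_sub_cancel_right]
      rw [show (n : ℤ) + 1 - (i + 1) = n - i by ring, show K - (i + 1) = K - 1 - i by ring]
      ring
    calc (1 - p ^ (n + 1)) * ∑' i : ℤ, eulerCoeffInt p i * eulerTheta p ((n + 1 : ℕ) - i) *
            eulerTheta p (K - i)
        = ∑' i : ℤ, (eulerCoeffInt p i * (1 - p ^ i) *
            (eulerTheta p (n + 1 - i) * eulerTheta p (K - i)) +
            eulerCoeffInt p i * p ^ i * (eulerTheta p (n - i) * eulerTheta p (K - i))) := by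
          rw [← tsum_mul_left]
          refine tsum_congr fun i => ?_
          have e := eulerTheta_pred hp0 hp1 ((n : ℤ) + 1 - i)
          rw [show (n : ℤ) + 1 - i - 1 = n - i by ring, zpow_sub₀ hp0.ne'] at e
          have e' : p ^ i * eulerTheta p (n - i) =
              (p ^ i - p ^ (n + 1)) * eulerTheta p (n + 1 - i) := by
            rw [e]
            have : p ^ i ≠ 0 := zpow_ne_zero _ hp0.ne'
            have h' : p ^ ((n : ℤ) + 1) = p ^ (n + 1) := by norm_cast
            rw [h']
            field_simp
          push_cast
          linear_combination (-eulerCoeffInt p i * eulerTheta p (K - i)) * e'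
      _ = ∑' i : ℤ, (eulerCoeffInt p i * p ^ i * (eulerTheta p (n - i) * eulerTheta p (K - i)) -
            eulerCoeffInt p i * p ^ i * (eulerTheta p (n - i) * eulerTheta p (K - 1 - i))) := by
          rw [Summable.tsum_add _ h3, hshift, h3.tsum_sub h4]
          · ring
          · exact (h1.sub h2).congr fun i => by ring
      _ = ∑' i : ℤ, p ^ K * (eulerCoeffInt p i * eulerTheta p (n - i) * eulerTheta p (K - i)) := by
          refine tsum_congr fun i => ?_
          have e := eulerTheta_pred hp0 hp1 (K - i)
          have e2 : p ^ i * p ^ (K - i) = p ^ K := by rw [← zpow_add₀ hp0.ne']; congr 1; ring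
          rw [show K - 1 - i = K - i - 1 by ring, e, ← e2]
          ring
      _ = _ := by
          rw [tsum_mul_left, ih, hth]
          push_cast
          rw [add_mul, one_mul, zpow_add₀ hp0.ne']
          ring

lemma tsum_eulerCoeffInt_mul_eulerCoeffInt (hp0 : 0 < p) (hp1 : p < 1) (n : ℕ) (K : ℤ) :
    ∑' i : ℤ, eulerCoeffInt p (n - i) * eulerCoeffInt p (K - i) * (p ^ (-i) * eulerTheta p i) =
      eulerTheta p 0 * p ^ (-(n * K)) * eulerCoeffInt p n * eulerCoeffInt p K := by
  induction n with
  | zero =>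
    rw [tsum_eq_single 0]
    · simp [eulerCoeffInt_zero]; ring
    · intro i hi
      rcases lt_or_gt_of_ne hi with hi | hi
      · simp [eulerTheta_of_neg hp0 hp1 hi]
      · simp [eulerCoeffInt_of_neg p (show -i < 0 by omega)]
  | succ n ih =>
    have hsum : ∀ f : ℤ → ℝ, (∀ i, i < 0 → f i = 0) → (∀ i, (n : ℤ) + 1 < i → f i = 0) →
        Summable f := fun f h1 h2 => by
      refine summable_of_hasFiniteSupport ((Set.finite_Icc (0 : ℤ) (n + 1)).subset fun i hi => ?_)
      by_contra hc
      rw [Set.mem_Icc, not_and_or, not_le, not_le] at hc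
      exact hi (hc.elim (h1 i) (h2 i))
    have hne : (1 - p ^ (n + 1)) ≠ 0 := (one_sub_pow_succ_pos hp0 hp1 n).ne'
    refine mul_left_cancel₀ hne ?_
    have hz : ∀ m : ℤ, p ^ m ≠ 0 := fun m => zpow_ne_zero _ hp0.ne'
    have hshift : ∑' i : ℤ, p ^ (n + 1 - i) * (eulerCoeffInt p (n + 1 - i) *
          eulerCoeffInt p (K - i) * (p ^ (-i) * eulerTheta p (i - 1))) =
        ∑' i : ℤ, p ^ (n - i) * (eulerCoeffInt p (n - i) *
          eulerCoeffInt p (K - 1 - i) * (p ^ (-i - 1) * eulerTheta p i)) := by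
      rw [← (Equiv.addRight (1 : ℤ)).tsum_eq]
      refine tsum_congr fun i => ?_
      simp only [Equiv.coe_addRight, add_sub_cancel_right]
      rw [show (n : ℤ) + 1 - (i + 1) = n - i by ring, show K - (i + 1) = K - 1 - i by ring,
        show -(i + 1) = -i - 1 by ring]
    calc (1 - p ^ (n + 1)) * ∑' i : ℤ, eulerCoeffInt p ((n + 1 : ℕ) - i) *
            eulerCoeffInt p (K - i) * (p ^ (-i) * eulerTheta p i)
        = ∑' i : ℤ, (-p ^ (n - i) * eulerCoeffInt p (n - i) * eulerCoeffInt p (K - i) *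
              (p ^ (-i) * eulerTheta p i) +
            p ^ (n + 1 - i) * (eulerCoeffInt p (n + 1 - i) *
              eulerCoeffInt p (K - i) * (p ^ (-i) * eulerTheta p (i - 1)))) := by
          rw [← tsum_mul_left]
          refine tsum_congr fun i => ?_
          have e1 := eulerCoeffInt_mul hp0 hp1 ((n : ℤ) + 1 - i)
          have e2 := eulerTheta_pred hp0 hp1 i
          rw [show (n : ℤ) + 1 - i - 1 = n - i by ring] at e1
          have e3 : p ^ (n + 1) = p ^ ((n : ℤ) + 1 - i) * p ^ i := by
            rw [← zpow_add₀ hp0.ne', sub_add_cancel]; norm_cast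
          rw [e2, e3]
          push_cast
          linear_combination (eulerCoeffInt p (K - i) * (p ^ (-i) * eulerTheta p i)) * e1
      _ = ∑' i : ℤ, (-p ^ (n - i) * eulerCoeffInt p (n - i) * eulerCoeffInt p (K - i) *
              (p ^ (-i) * eulerTheta p i) +
            p ^ (n - i) * (eulerCoeffInt p (n - i) *
              eulerCoeffInt p (K - 1 - i) * (p ^ (-i - 1) * eulerTheta p i))) := by
          rw [Summable.tsum_add, hshift, ← Summable.tsum_add]
          all_goals
            refine hsum _ (fun i hi => ?_) (fun i hi => ?_)
          · simp [eulerTheta_of_neg hp0 hp1 hi]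
          · simp [eulerCoeffInt_of_neg p (show n - i < 0 by omega)]
          · simp [eulerTheta_of_neg hp0 hp1 hi]
          · simp [eulerCoeffInt_of_neg p (show n - i < 0 by omega)]
          · simp [eulerTheta_of_neg hp0 hp1 hi]
          · simp [eulerCoeffInt_of_neg p (show n - i < 0 by omega)]
          · simp [eulerTheta_of_neg hp0 hp1 (show i - 1 < 0 by omega)]
          · simp [eulerCoeffInt_of_neg p (show n + 1 - i < 0 by omega)]
      _ = ∑' i : ℤ, -p ^ (n - K) * (eulerCoeffInt p (n - i) * eulerCoeffInt p (K - i) *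
            (p ^ (-i) * eulerTheta p i)) := by
          refine tsum_congr fun i => ?_
          have e := eulerCoeffInt_mul hp0 hp1 (K - i)
          have e2 : p ^ (n - i) * p ^ (-i - 1) = p ^ (n - K) * p ^ (-i) * p ^ (K - i - 1) := by
            rw [← zpow_add₀ hp0.ne', ← zpow_add₀ hp0.ne', ← zpow_add₀ hp0.ne']; congr 1; ring
          have e3 : p ^ (n - K) * p ^ (K - i) = p ^ (n - i) := by
            rw [← zpow_add₀ hp0.ne']; congr 1; ring
          rw [show K - 1 - i = K - i - 1 by ring]
          rw [← e3] at e2 ⊢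
          linear_combination
            (eulerCoeffInt p (n - i) * eulerTheta p i * eulerCoeffInt p (K - i - 1)) * e2
            + (p ^ (n - K) * p ^ (-i) * eulerCoeffInt p (n - i) * eulerTheta p i) * e
      _ = _ := by
          rw [tsum_mul_left, ih]
          have e := eulerCoeffInt_mul hp0 hp1 ((n : ℤ) + 1)
          have e4 : p ^ ((n : ℤ) + 1) = p ^ (n + 1) := by norm_cast
          rw [add_sub_cancel_right, e4] at e
          have e5 : p ^ (n - K) * p ^ (-(n * K)) = p ^ (-((n + 1) * K)) * p ^ (n : ℤ) := by
            rw [← zpow_add₀ hp0.ne', ← zpow_add₀ hp0.ne']; congr 1; ring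
          push_cast
          linear_combination (-eulerTheta p 0 * eulerCoeffInt p n * eulerCoeffInt p K) * e5
            - (eulerTheta p 0 * p ^ (-((n + 1) * K)) * eulerCoeffInt p K) * e

end Vandermonde

section TripleProduct

variable {p a : ℝ}

lemma summable_besselLattice (hp0 : 0 < p) (hp1 : p < 1) (ha : 0 ≤ a) (n : ℤ) :
    Summable fun k : ℤ => eulerCoeffInt p k * a ^ k * eulerTheta p (n + k) :=
  summable_eulerCoeffInt_mul_bounded hp0 hp1 ha fun k => abs_eulerTheta_le hp0 hp1 (n + k)

lemma summable_zpow_mul_eulerTheta (hp0 : 0 < p) (hp1 : p < 1) (ha0 : 0 < a) (ha1 : a < 1) :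
    Summable fun I : ℤ => a ^ I * |eulerTheta p I| := by
  rw [summable_int_iff_summable_nat fun m hm => by simp [eulerTheta_of_neg hp0 hp1 hm]]
  refine Summable.of_nonneg_of_le (fun k => by positivity) (fun k => ?_)
    ((summable_geometric_of_lt_one ha0.le ha1).mul_right (∑' k : ℕ, |eulerCoeff p k|))
  rw [zpow_natCast]
  exact mul_le_mul_of_nonneg_left (abs_eulerTheta_le hp0 hp1 k) (by positivity)

lemma tsum_mul_tsum_mul_tsum {f g h : ℤ → ℝ} (hf : Summable fun i => ‖f i‖)
    (hg : Summable fun i => ‖g i‖) (hh : Summable fun i => ‖h i‖) :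
    ∑' x : ℤ × ℤ × ℤ, f x.1 * (g x.2.1 * h x.2.2) =
      (∑' i, f i) * ((∑' i, g i) * ∑' i, h i) := by
  rw [tsum_mul_tsum_of_summable_norm hg hh,
    tsum_mul_tsum_of_summable_norm hf (hg.mul_norm hh)]

lemma summable_tripleProduct (hp0 : 0 < p) (hp1 : p < 1) (ha0 : 0 < a) (ha1 : a < 1) :
    Summable fun x : (ℤ × ℤ × ℤ) × ℤ =>
      (a ^ x.1.1 * eulerTheta p x.1.1 * (eulerCoeffInt p x.1.2.1 * a ^ x.1.2.1 *
        (eulerCoeffInt p x.1.2.2 * p ^ x.1.2.2))) *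
      (eulerCoeffInt p x.2 * eulerTheta p (x.1.1 + x.1.2.1 - x.2) *
        eulerTheta p (x.1.1 + x.1.2.2 - x.2)) := by
  have hI := summable_zpow_mul_eulerTheta hp0 hp1 ha0 ha1
  have hj := summable_eulerCoeffInt hp0 hp1 ha0.le
  have hk := summable_eulerCoeffInt hp0 hp1 hp0.le
  have hi := summable_eulerCoeffInt hp0 hp1 zero_le_one
  simp only [one_zpow, mul_one] at hi
  have hjk := hj.mul_of_nonneg hk (fun _ => by positivity) (fun _ => by positivity)
  have hIjk := hI.mul_of_nonneg hjk (fun _ => by positivity)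
    (fun _ => mul_nonneg (by positivity) (by positivity))
  have hall := hIjk.mul_of_nonneg hi
    (fun _ => mul_nonneg (by positivity) (mul_nonneg (by positivity) (by positivity)))
    (fun _ => abs_nonneg _)
  refine Summable.of_norm_bounded (hall.mul_right ((∑' k : ℕ, |eulerCoeff p k|) ^ 2)) fun x => ?_
  have hb := abs_eulerTheta_mul_le hp0 hp1 (x.1.1 + x.1.2.1 - x.2) (x.1.1 + x.1.2.2 - x.2)
  rw [abs_mul] at hb
  simp only [norm_mul, norm_zpow, Real.norm_eq_abs, abs_of_pos ha0, abs_of_pos hp0]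
  rw [show ∀ A B C D : ℝ, A * (B * C * D) = A * B * (C * D) by intros; ring]
  exact mul_le_mul_of_nonneg_left hb (by positivity)

/-- The `q`-integral of `J_v(t)² J_0(t)` factorizes. -/
lemma tsum_besselLattice_triple (hp0 : 0 < p) (hp1 : p < 1) (ha0 : 0 < a) (ha1 : a < 1) :
    ∑' n : ℤ, a ^ n * besselLattice p a n * (besselLattice p a n * besselLattice p p n) =
      eulerTheta p 0 * (besselLattice p a 0 * besselLattice p p 0) := by
  have hF := summable_tripleProduct hp0 hp1 ha0 ha1
  set F : (ℤ × ℤ × ℤ) × ℤ → ℝ := fun x =>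
      (a ^ x.1.1 * eulerTheta p x.1.1 * (eulerCoeffInt p x.1.2.1 * a ^ x.1.2.1 *
        (eulerCoeffInt p x.1.2.2 * p ^ x.1.2.2))) *
      (eulerCoeffInt p x.2 * eulerTheta p (x.1.1 + x.1.2.1 - x.2) *
        eulerTheta p (x.1.1 + x.1.2.2 - x.2)) with hFdef
  have hsa := fun n => summable_besselLattice hp0 hp1 ha0.le n
  have hsp := fun n => summable_besselLattice hp0 hp1 hp0.le n
  let e₁ : ℤ × (ℤ × ℤ × ℤ) ≃ (ℤ × ℤ × ℤ) × ℤ :=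
    { toFun := fun x => (x.2, x.2.1 - x.1)
      invFun := fun x => (x.1.1 - x.2, x.1)
      left_inv := fun x => by simp
      right_inv := fun x => by simp }
  have h1 : ∑' x, F x =
      ∑' n : ℤ, a ^ n * besselLattice p a n * (besselLattice p a n * besselLattice p p n) := by
    have hF₁ : Summable fun x => F (e₁ x) := (e₁.summable_iff).2 hF
    rw [← e₁.tsum_eq, hF₁.tsum_prod]
    refine tsum_congr fun n => ?_
    have hshift : a ^ n * besselLattice p a n =
        ∑' I : ℤ, eulerCoeffInt p (I - n) * a ^ I * eulerTheta p I := by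
      rw [← (Equiv.addRight n).tsum_eq, besselLattice, ← tsum_mul_left]
      refine tsum_congr fun I => ?_
      simp only [Equiv.coe_addRight, add_sub_cancel_right]
      rw [zpow_add₀ ha0.ne', add_comm n I]
      ring
    have hs : Summable fun I : ℤ => eulerCoeffInt p (I - n) * a ^ I * eulerTheta p I := by
      rw [← (Equiv.addRight n).summable_iff]
      refine ((hsa n).mul_left (a ^ n)).congr fun I => ?_
      simp only [Function.comp, Equiv.coe_addRight, add_sub_cancel_right]
      rw [zpow_add₀ ha0.ne', add_comm n I]
      ring
    rw [hshift, besselLattice, besselLattice,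
      ← tsum_mul_tsum_mul_tsum hs.norm (hsa n).norm (hsp n).norm]
    refine tsum_congr fun x => ?_
    simp only [hFdef, e₁, Equiv.coe_fn_mk]
    rw [show x.1 + x.2.1 - (x.1 - n) = n + x.2.1 by ring,
      show x.1 + x.2.2 - (x.1 - n) = n + x.2.2 by ring]
    ring
  let e₂ : (ℤ × ℤ) × ℤ ≃ ℤ × ℤ × ℤ :=
    { toFun := fun x => (x.2, x.1.1 - x.2, x.1.2 - x.2)
      invFun := fun x => ((x.2.1 + x.1, x.2.2 + x.1), x.1)
      left_inv := fun x => by simp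
      right_inv := fun x => by simp }
  have h2 : ∑' x, F x = eulerTheta p 0 * (besselLattice p a 0 * besselLattice p p 0) := by
    have hF₂ : Summable fun x => ∑' i, F (e₂ x, i) := (e₂.summable_iff).2 hF.prod
    rw [hF.tsum_prod, ← e₂.tsum_eq, hF₂.tsum_prod, besselLattice,
      besselLattice, tsum_mul_tsum_of_summable_norm (hsa 0).norm (hsp 0).norm, ← tsum_mul_left]
    refine tsum_congr fun x => ?_
    obtain ⟨N, K⟩ := x
    simp only [hFdef, e₂, Equiv.coe_fn_mk, add_sub_cancel, tsum_mul_left, zero_add,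
      tsum_eulerCoeffInt_mul_eulerTheta hp0 hp1]
    rcases lt_or_ge N 0 with hN | hN
    · simp [eulerTheta_of_neg hp0 hp1 hN]
    obtain ⟨n, rfl⟩ := Int.eq_ofNat_of_zero_le hN
    have h := tsum_eulerCoeffInt_mul_eulerCoeffInt hp0 hp1 n K
    calc _ = ∑' i : ℤ, (a ^ (n : ℤ) * p ^ K * p ^ (n * K) * eulerTheta p n * eulerTheta p K) *
          (eulerCoeffInt p (n - i) * eulerCoeffInt p (K - i) * (p ^ (-i) * eulerTheta p i)) := by
          refine tsum_congr fun i => ?_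
          rw [zpow_sub₀ ha0.ne', zpow_sub₀ hp0.ne', zpow_neg]
          have : a ^ i ≠ 0 := zpow_ne_zero _ ha0.ne'
          field_simp
      _ = _ := by
          rw [tsum_mul_left, h, zpow_neg]
          have : p ^ (n * K) ≠ 0 := zpow_ne_zero _ hp0.ne'
          field_simp
  rw [← h1, h2]

end TripleProduct

section Sonine

variable {p a : ℝ}

lemma tsum_eulerCoeff_mul_eulerFun_comm (hp0 : 0 < p) (hp1 : p < 1) {x y : ℝ} (hx : 0 ≤ x)
    (hy : 0 ≤ y) :
    ∑' k : ℕ, eulerCoeff p k * y ^ k * eulerFun p (x * p ^ k) =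
      ∑' i : ℕ, eulerCoeff p i * x ^ i * eulerFun p (y * p ^ i) := by
  have hs : Summable fun z : ℕ × ℕ =>
      eulerCoeff p z.1 * y ^ z.1 * (eulerCoeff p z.2 * (x * p ^ z.1) ^ z.2) := by
    refine Summable.of_norm_bounded ((summable_eulerCoeff hp0 hp1 hy).mul_of_nonneg
      (summable_eulerCoeff hp0 hp1 hx) (fun _ => by positivity) (fun _ => by positivity))
      fun z => ?_
    simp only [norm_mul, norm_pow, Real.norm_eq_abs, abs_of_nonneg hx, abs_of_nonneg hy,
      abs_of_pos hp0]
    gcongr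
    exact mul_le_of_le_one_right hx (pow_le_one₀ hp0.le hp1.le)
  simp only [eulerFun, ← tsum_mul_left]
  rw [Summable.tsum_comm (by exact hs.prod_symm)]
  refine tsum_congr fun i => tsum_congr fun k => ?_
  simp only [mul_pow, ← pow_mul]
  ring

lemma besselLattice_eq (hp0 : 0 < p) (hp1 : p < 1) (ha : 0 ≤ a) (n : ℤ) :
    besselLattice p a n =
      ∑' k : ℕ, eulerCoeff p k * (p ^ (n + 1)) ^ k * eulerFun p (a * p ^ k) := by
  rw [tsum_eulerCoeff_mul_eulerFun_comm hp0 hp1 ha (by positivity), besselLattice,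
    tsum_int_eq_tsum_nat fun m hm => by simp [eulerCoeffInt_of_neg p hm]]
  refine tsum_congr fun k => ?_
  rw [eulerCoeffInt_natCast, zpow_natCast, eulerTheta, ← zpow_natCast p k, ← zpow_add₀ hp0.ne',
    show n + k + 1 = n + 1 + (k : ℤ) by ring]

lemma eulerCoeff_sq_eq (q x : ℝ) (k : ℕ) :
    (-1 : ℝ) ^ k * q ^ (k * (k + 1)) * x ^ (2 * k) / qPoch (q ^ 2) (q ^ 2) k =
      eulerCoeff (q ^ 2) k * (q ^ 2 * x ^ 2) ^ k := by
  induction k with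
  | zero => simp [qPoch, eulerCoeff_zero]
  | succ k ih =>
    rw [eulerCoeff_succ, pow_succ (q ^ 2 * x ^ 2), ← mul_assoc, mul_right_comm (eulerCoeff _ _),
      ← ih, qPoch, qPoch, Finset.prod_range_succ,
      show 1 - q ^ 2 * (q ^ 2) ^ k = 1 - (q ^ 2) ^ (k + 1) by ring]
    generalize 1 - (q ^ 2) ^ (k + 1) = d
    generalize ∏ i ∈ Finset.range k, (1 - q ^ 2 * (q ^ 2) ^ i) = P
    ring

lemma eulerFun_mul_jHE {q v : ℝ} (hq0 : 0 < q) (hq1 : q < 1) (hv : -1 < v) (n : ℤ) :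
    eulerFun (q ^ 2) (q ^ (2 * v + 2)) * jHE q v (q ^ n) =
      besselLattice (q ^ 2) (q ^ (2 * v + 2)) n := by
  have hp0 : 0 < q ^ 2 := by positivity
  have hp1 : q ^ 2 < 1 := pow_lt_one₀ hq0.le hq1 two_ne_zero
  have ha0 : 0 < q ^ (2 * v + 2) := by positivity
  have ha1 : q ^ (2 * v + 2) < 1 := Real.rpow_lt_one hq0.le hq1 (by linarith)
  rw [jHE]
  generalize q ^ (2 * v + 2) = a at *
  rw [besselLattice_eq hp0 hp1 ha0.le, ← tsum_mul_left]
  refine tsum_congr fun k => ?_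
  have h := (qPoch_pos hp0 hp1 ha0.le ha1 k).ne'
  rw [div_mul_eq_div_div, eulerCoeff_sq_eq, eulerFun_eq_qPoch hp0 hp1 ha0.le k,
    show (q ^ 2) ^ (n + 1) = q ^ 2 * (q ^ n) ^ 2 by
      rw [zpow_add_one₀ hp0.ne', mul_comm]; congr 1; rw [← zpow_natCast, ← zpow_natCast,
        zpow_comm]]
  field_simp

/-- The weights of the `q`-Sonine formula raising the order to zero. -/
def sonineWeight (p a : ℝ) (m : ℕ) : ℝ :=
  ∏ i ∈ Finset.range m, ((a - p ^ (i + 1)) / (1 - p ^ (i + 1)))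

lemma sonineWeight_succ (p a : ℝ) (m : ℕ) :
    sonineWeight p a (m + 1) =
      sonineWeight p a m * ((a - p ^ (m + 1)) / (1 - p ^ (m + 1))) :=
  Finset.prod_range_succ _ _

lemma sonineWeight_nonneg (hp0 : 0 < p) (hpa : p < a) (ha1 : a < 1) (m : ℕ) :
    0 ≤ sonineWeight p a m := by
  refine Finset.prod_nonneg fun i _ => div_nonneg ?_
    (one_sub_pow_succ_pos hp0 (hpa.trans ha1) i).le
  have : p ^ (i + 1) ≤ p := pow_le_of_le_one hp0.le (hpa.trans ha1).le (Nat.succ_ne_zero i)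
  linarith

lemma sonineWeight_le (hp0 : 0 < p) (hpa : p < a) (ha1 : a < 1) (m : ℕ) :
    sonineWeight p a m ≤ a ^ m := by
  induction m with
  | zero => simp [sonineWeight]
  | succ m ih =>
    have h1 := one_sub_pow_succ_pos hp0 (hpa.trans ha1) m
    have h2 : (a - p ^ (m + 1)) / (1 - p ^ (m + 1)) ≤ a := by
      rw [div_le_iff₀ h1]
      have : 0 < p ^ (m + 1) := by positivity
      nlinarith
    rw [sonineWeight_succ, pow_succ]
    refine (mul_le_mul_of_nonneg_left h2 (sonineWeight_nonneg hp0 hpa ha1 m)).trans ?_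
    exact mul_le_mul_of_nonneg_right ih (hp0.trans hpa).le

lemma summable_sonineWeight (hp0 : 0 < p) (hpa : p < a) (ha1 : a < 1) :
    Summable (sonineWeight p a) :=
  Summable.of_nonneg_of_le (sonineWeight_nonneg hp0 hpa ha1) (sonineWeight_le hp0 hpa ha1)
    (summable_geometric_of_lt_one (hp0.trans hpa).le ha1)

lemma summable_sonineWeight_mul_pow (hp0 : 0 < p) (hpa : p < a) (ha1 : a < 1) (k : ℕ) :
    Summable fun m : ℕ => sonineWeight p a m * p ^ (m * k) := by
  refine Summable.of_nonneg_of_le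
    (fun m => mul_nonneg (sonineWeight_nonneg hp0 hpa ha1 m) (by positivity)) (fun m => ?_)
    (summable_sonineWeight hp0 hpa ha1)
  exact mul_le_of_le_one_right (sonineWeight_nonneg hp0 hpa ha1 m)
    (pow_le_one₀ hp0.le (hpa.trans ha1).le)

lemma tsum_sonineWeight_mul_pow (hp0 : 0 < p) (hpa : p < a) (ha1 : a < 1) (k : ℕ) :
    (∑' m : ℕ, sonineWeight p a m * p ^ (m * k)) * eulerFun p (a * p ^ k) =
      (∑' m : ℕ, sonineWeight p a m) * eulerFun p a / eulerFun p p * eulerFun p (p * p ^ k) := by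
  have hp1 := hpa.trans ha1
  have ha0 := hp0.trans hpa
  induction k with
  | zero =>
    have := (eulerFun_pos hp0 hp1 hp0.le hp1).ne'
    simp
    field_simp
  | succ k ih =>
    have hs := summable_sonineWeight_mul_pow hp0 hpa ha1
    have hrec : (1 - a * p ^ k) * ∑' m : ℕ, sonineWeight p a m * p ^ (m * k) =
        (1 - p ^ (k + 1)) * ∑' m : ℕ, sonineWeight p a m * p ^ (m * (k + 1)) := by
      have e : ∑' m : ℕ, sonineWeight p a m * p ^ (m * k) -
          ∑' m : ℕ, sonineWeight p a m * p ^ (m * (k + 1)) =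
          a * p ^ k * ∑' m : ℕ, sonineWeight p a m * p ^ (m * k) -
            p ^ (k + 1) * ∑' m : ℕ, sonineWeight p a m * p ^ (m * (k + 1)) := by
        rw [← (hs k).tsum_sub (hs (k + 1)), ((hs k).sub (hs (k + 1))).tsum_eq_zero_add,
          ← tsum_mul_left, ← tsum_mul_left,
          ← ((hs k).mul_left _).tsum_sub ((hs (k + 1)).mul_left _)]
        simp only [zero_mul, pow_zero, sub_self, zero_add]
        refine tsum_congr fun m => ?_
        have := (one_sub_pow_succ_pos hp0 hp1 m).ne'
        rw [sonineWeight_succ]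
        have e2 : p ^ ((m + 1) * k) - p ^ ((m + 1) * (k + 1)) =
          (1 - p ^ (m + 1)) * (p ^ k * p ^ (m * k)) := by ring
        rw [← mul_sub, e2]
        field_simp
        ring
      linear_combination e
    have e1 := eulerFun_eq hp0 hp1 (z := a * p ^ k) (by positivity)
    have e2 := eulerFun_eq hp0 hp1 (z := p * p ^ k) (by positivity)
    refine mul_left_cancel₀ (one_sub_pow_succ_pos hp0 hp1 k).ne' ?_
    rw [e1, e2] at ih
    rw [show p * (a * p ^ k) = a * p ^ (k + 1) by ring] at ih
    rw [show p * (p * p ^ k) = p * p ^ (k + 1) by ring] at ih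
    rw [← mul_assoc, ← hrec]
    linear_combination ih

/-- The `q`-Sonine formula. -/
lemma tsum_sonineWeight_mul_besselLattice (hp0 : 0 < p) (hpa : p < a) (ha1 : a < 1) (n : ℤ) :
    ∑' m : ℕ, sonineWeight p a m * besselLattice p a (n + m) =
      (∑' m : ℕ, sonineWeight p a m) * eulerFun p a / eulerFun p p * besselLattice p p n := by
  have hp1 := hpa.trans ha1
  have ha0 := hp0.trans hpa
  have hle : ∀ k : ℕ, a * p ^ k ≤ 1 := fun k =>
    mul_le_one₀ ha1.le (by positivity) (pow_le_one₀ hp0.le hp1.le)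
  have hy : 0 ≤ p ^ (n + 1) := by positivity
  have hs : Summable fun z : ℕ × ℕ => sonineWeight p a z.1 *
      (eulerCoeff p z.2 * (p ^ (n + z.1 + 1)) ^ z.2 * eulerFun p (a * p ^ z.2)) := by
    refine Summable.of_norm_bounded (((summable_sonineWeight hp0 hpa ha1).mul_of_nonneg
      (summable_eulerCoeff hp0 hp1 hy) (fun m => sonineWeight_nonneg hp0 hpa ha1 m)
      (fun _ => by positivity)).mul_right (∑' k : ℕ, |eulerCoeff p k|)) fun z => ?_
    have h0 := sonineWeight_nonneg hp0 hpa ha1 z.1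
    have h1 := abs_eulerFun_le hp0 hp1 (z := a * p ^ z.2) (by positivity) (hle z.2)
    have h2 : p ^ (n + z.1 + 1) ≤ p ^ (n + 1) := zpow_le_zpow_right_of_le_one₀ hp0 hp1.le (by omega)
    simp only [norm_mul, norm_pow, norm_zpow, Real.norm_eq_abs, abs_of_pos hp0, abs_of_nonneg h0]
    rw [mul_assoc (sonineWeight p a z.1)]
    gcongr
  rw [besselLattice_eq hp0 hp1 hp0.le, ← tsum_mul_left]
  simp only [besselLattice_eq hp0 hp1 ha0.le, ← tsum_mul_left]
  rw [Summable.tsum_comm (by exact hs.prod_symm)]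
  refine tsum_congr fun k => ?_
  have h := tsum_sonineWeight_mul_pow hp0 hpa ha1 k
  rw [mul_left_comm, ← h, ← tsum_mul_right, ← tsum_mul_left]
  refine tsum_congr fun m => ?_
  rw [show n + m + 1 = n + 1 + (m : ℤ) by ring, zpow_add₀ hp0.ne', mul_pow, zpow_natCast, pow_mul]
  ring

end Sonine

section Oscillation

variable {p : ℝ}

/-- The absolute values of the coefficients of `₁φ₁(0;p;p,z)`. -/
def phiCoeff (p : ℝ) (k : ℕ) : ℝ := ∏ i ∈ Finset.range k, (p ^ i / (1 - p ^ (i + 1)) ^ 2)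

/-- The function `₁φ₁(0;p;p,z)`. -/
def phiFun (p z : ℝ) : ℝ := ∑' k : ℕ, (-1 : ℝ) ^ k * (phiCoeff p k * z ^ k)

lemma phiCoeff_succ (p : ℝ) (k : ℕ) :
    phiCoeff p (k + 1) = phiCoeff p k * (p ^ k / (1 - p ^ (k + 1)) ^ 2) :=
  Finset.prod_range_succ _ _

lemma phiCoeff_pos (hp0 : 0 < p) (hp1 : p < 1) (k : ℕ) : 0 < phiCoeff p k :=
  Finset.prod_pos fun i _ => div_pos (by positivity) (pow_pos (one_sub_pow_succ_pos hp0 hp1 i) 2)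

lemma eulerCoeff_eq_phiCoeff (hp0 : 0 < p) (hp1 : p < 1) (k : ℕ) :
    eulerCoeff p k = (-1) ^ k * phiCoeff p k * qPoch p p k := by
  induction k with
  | zero => simp [eulerCoeff_zero, phiCoeff, qPoch]
  | succ k ih =>
    have := (one_sub_pow_succ_pos hp0 hp1 k).ne'
    rw [eulerCoeff_succ, ih, phiCoeff_succ, qPoch, qPoch, Finset.prod_range_succ,
      show 1 - p * p ^ k = 1 - p ^ (k + 1) by ring]
    field_simp
    ring

lemma besselLattice_zero (hp0 : 0 < p) (hp1 : p < 1) (a : ℝ) :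
    besselLattice p a 0 = eulerFun p p * phiFun p a := by
  rw [besselLattice, tsum_int_eq_tsum_nat fun m hm => by simp [eulerCoeffInt_of_neg p hm],
    phiFun, ← tsum_mul_left]
  refine tsum_congr fun k => ?_
  have e : eulerTheta p (0 + k) = eulerFun p (p * p ^ k) := by
    rw [eulerTheta, zero_add, ← pow_succ']; norm_cast
  rw [eulerCoeffInt_natCast, zpow_natCast, eulerCoeff_eq_phiCoeff hp0 hp1, e,
    eulerFun_eq_qPoch hp0 hp1 hp0.le k]
  ring

lemma phiCoeff_ratio_le (h1 : 21 / 50 ≤ p) (h2 : p ≤ 11 / 25) (k : ℕ) :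
    p ^ (k + 1) * (1 + p) / (1 - p ^ (k + 2)) ^ 2 ≤ 49 / 50 := by
  have hp0 : 0 < p := by linarith
  have e1 : p ^ (k + 1) ≤ 11 / 25 :=
    (pow_le_of_le_one hp0.le (by linarith) (Nat.succ_ne_zero k)).trans h2
  have e2 : p ^ (k + 2) ≤ (11 / 25) ^ 2 :=
    (pow_le_pow_of_le_one hp0.le (by linarith) (by omega)).trans
      (pow_le_pow_left₀ hp0.le h2 2)
  have e3 : (1 - (11 / 25 : ℝ) ^ 2) ^ 2 ≤ (1 - p ^ (k + 2)) ^ 2 :=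
    pow_le_pow_left₀ (by norm_num) (by linarith) 2
  rw [div_le_iff₀ (lt_of_lt_of_le (by norm_num) e3)]
  have : p ^ (k + 1) * (1 + p) ≤ 11 / 25 * (1 + 11 / 25) := by gcongr
  norm_num at e3 this
  linarith

lemma phiCoeff_mul_pow_ratio_le (h1 : 21 / 50 ≤ p) (h2 : p ≤ 11 / 25) (k : ℕ) :
    phiCoeff p (k + 2) * p ^ (k + 2) ≤ 3 / 10 * (phiCoeff p (k + 1) * p ^ (k + 1)) := by
  have hp0 : 0 < p := by linarith
  have hb := phiCoeff_pos hp0 (by linarith) (k + 1)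
  have e2 : p ^ (k + 2) ≤ (11 / 25) ^ 2 :=
    (pow_le_pow_of_le_one hp0.le (by linarith) (by omega)).trans
      (pow_le_pow_left₀ hp0.le h2 2)
  have e3 : (1 - (11 / 25 : ℝ) ^ 2) ^ 2 ≤ (1 - p ^ (k + 2)) ^ 2 :=
    pow_le_pow_left₀ (by norm_num) (by linarith) 2
  have e4 : p ^ (k + 2) / (1 - p ^ (k + 2)) ^ 2 ≤ 3 / 10 := by
    rw [div_le_iff₀ (lt_of_lt_of_le (by norm_num) e3)]
    norm_num at e2 e3
    linarith
  calc phiCoeff p (k + 2) * p ^ (k + 2)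
      = p ^ (k + 2) / (1 - p ^ (k + 2)) ^ 2 * (phiCoeff p (k + 1) * p ^ (k + 1)) := by
        rw [phiCoeff_succ p (k + 1)]; ring
    _ ≤ _ := by gcongr

lemma phiCoeff_mul_pow_le (h1 : 21 / 50 ≤ p) (h2 : p ≤ 11 / 25) (k : ℕ) :
    phiCoeff p k * p ^ k ≤ 5 * (3 / 10) ^ k := by
  rcases k with _ | k
  · norm_num [phiCoeff]
  induction k with
  | zero =>
    have : (0 : ℝ) < 1 - p := by linarith
    simp only [phiCoeff, zero_add, Finset.prod_range_one, pow_zero, pow_one]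
    rw [div_mul_eq_mul_div, one_mul, div_le_iff₀ (by positivity)]
    nlinarith
  | succ k ih =>
    refine (phiCoeff_mul_pow_ratio_le h1 h2 k).trans ?_
    rw [pow_succ _ (k + 1)]
    linarith

lemma summable_phiCoeff (h1 : 21 / 50 ≤ p) (h2 : p ≤ 11 / 25) : Summable (phiCoeff p) := by
  have hp0 : 0 < p := by linarith
  refine Summable.of_nonneg_of_le (fun k => (phiCoeff_pos hp0 (by linarith) k).le) (fun k => ?_)
    ((summable_geometric_of_lt_one (r := 5 / 7) (by norm_num) (by norm_num)).mul_left 5)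
  have h := phiCoeff_mul_pow_le h1 h2 k
  have hb := phiCoeff_pos hp0 (by linarith) k
  have h3 : (21 / 50 : ℝ) ^ k ≤ p ^ k := pow_le_pow_left₀ (by norm_num) h1 k
  have h4 : (3 / 10 : ℝ) ^ k = (5 / 7) ^ k * (21 / 50) ^ k := by rw [← mul_pow]; norm_num
  have h5 : (0 : ℝ) < (21 / 50) ^ k := by positivity
  refine le_of_mul_le_mul_right ?_ h5
  calc phiCoeff p k * (21 / 50) ^ k ≤ phiCoeff p k * p ^ k := by gcongr
    _ ≤ _ := by rw [mul_assoc, ← h4]; exact h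

lemma summable_phiCoeff_mul_pow (h1 : 21 / 50 ≤ p) (h2 : p ≤ 11 / 25) {z : ℝ} (hz : 0 ≤ z)
    (hz1 : z ≤ 1) : Summable fun k : ℕ => (-1 : ℝ) ^ k * (phiCoeff p k * z ^ k) := by
  have hp0 : 0 < p := by linarith
  refine Summable.of_norm_bounded (summable_phiCoeff h1 h2) fun k => ?_
  have hb := phiCoeff_pos hp0 (by linarith) k
  rw [norm_mul, norm_pow, norm_neg, norm_one, one_pow, one_mul,
    Real.norm_of_nonneg (by positivity)]
  exact mul_le_of_le_one_right hb.le (pow_le_one₀ hz hz1)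

lemma hasSum_phiFun_tail (h1 : 21 / 50 ≤ p) (h2 : p ≤ 11 / 25) {z : ℝ} (hz : 0 ≤ z)
    (hz1 : z ≤ 1) :
    HasSum (fun k : ℕ => (-1 : ℝ) ^ k * (phiCoeff p (k + 1) * z ^ (k + 1))) (1 - phiFun p z) := by
  have h := summable_phiCoeff_mul_pow h1 h2 hz hz1
  have h' := ((summable_nat_add_iff 1).2 h).hasSum.neg
  have e : (fun k : ℕ => (-1 : ℝ) ^ k * (phiCoeff p (k + 1) * z ^ (k + 1))) =
      fun k => -((-1 : ℝ) ^ (k + 1) * (phiCoeff p (k + 1) * z ^ (k + 1))) := by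
    funext k; ring
  have e0 : phiCoeff p 0 = 1 := by simp [phiCoeff]
  rw [phiFun, h.tsum_eq_zero_add, e, e0, pow_zero, pow_zero, one_mul, one_mul, sub_add_cancel_left]
  exact h'

lemma antitone_phiCoeff_mul_pow (h1 : 21 / 50 ≤ p) (h2 : p ≤ 11 / 25) :
    Antitone fun k : ℕ => phiCoeff p (k + 1) * p ^ (k + 1) := by
  have hp0 : 0 < p := by linarith
  refine antitone_nat_of_succ_le fun k => (phiCoeff_mul_pow_ratio_le h1 h2 k).trans ?_
  have := phiCoeff_pos hp0 (by linarith) (k + 1)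
  have : 0 < phiCoeff p (k + 1) * p ^ (k + 1) := by positivity
  linarith

lemma phiFun_left_pos : 0 < phiFun (21 / 50) (21 / 50) := by
  have h := (antitone_phiCoeff_mul_pow (p := 21 / 50) le_rfl (by norm_num)
    ).tendsto_le_alternating_series
      (hasSum_phiFun_tail le_rfl (by norm_num) (by norm_num) (by norm_num)).tendsto_sum_nat 1
  norm_num [Finset.sum_range_succ, phiCoeff, Finset.prod_range_succ] at h
  linarith

lemma phiFun_right_neg : phiFun (11 / 25) (11 / 25) < 0 := by
  have h := (antitone_phiCoeff_mul_pow (p := 11 / 25) (by norm_num) le_rfl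
    ).alternating_series_le_tendsto
      (hasSum_phiFun_tail (by norm_num) le_rfl (by norm_num) (by norm_num)).tendsto_sum_nat 2
  norm_num [Finset.sum_range_succ, phiCoeff, Finset.prod_range_succ] at h
  linarith

lemma continuousOn_phiFun_diag :
    ContinuousOn (fun p => phiFun p p) (Set.Icc (21 / 50) (11 / 25)) := by
  refine continuousOn_tsum (u := fun k : ℕ => 5 * (3 / 10 : ℝ) ^ k) (fun k => ?_)
    ((summable_geometric_of_lt_one (by norm_num) (by norm_num)).mul_left 5) fun k x hx => ?_
  · refine continuousOn_const.mul (ContinuousOn.mul ?_ (continuousOn_id.pow k))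
    refine continuousOn_finsetProd _ fun i _ => ?_
    refine (continuousOn_id.pow i).div
      ((continuousOn_const.sub (continuousOn_id.pow (i + 1))).pow 2) fun x hx => ?_
    exact (pow_pos (one_sub_pow_succ_pos (by linarith [hx.1]) (by linarith [hx.2]) i) 2).ne'
  · have hx0 : 0 < x := by linarith [hx.1]
    have := phiCoeff_pos hx0 (by linarith [hx.2]) k
    rw [norm_mul, norm_pow, norm_neg, norm_one, one_pow, one_mul,
      Real.norm_of_nonneg (by positivity)]
    exact phiCoeff_mul_pow_le hx.1 hx.2 k

lemma phiFun_sub_ge (h1 : 21 / 50 ≤ p) (h2 : p ≤ 11 / 25) {z : ℝ} (hz : p ≤ z) (hz1 : z ≤ 1) :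
    (z - p) / 50 ≤ phiFun p p - phiFun p z := by
  have hp0 : 0 < p := by linarith
  have hp1 : p < 1 := by linarith
  have hz0 : 0 ≤ z := hp0.le.trans hz
  have hsum : HasSum (fun k : ℕ => (-1 : ℝ) ^ k *
      (phiCoeff p (k + 1) * (z ^ (k + 1) - p ^ (k + 1)))) (phiFun p p - phiFun p z) := by
    have h := (hasSum_phiFun_tail h1 h2 hz0 hz1).sub (hasSum_phiFun_tail h1 h2 hp0.le hp1.le)
    rw [sub_sub_sub_cancel_left] at h
    exact h.congr_fun fun k => by ring
  have hstep : ∀ k : ℕ, z ^ (k + 2) - p ^ (k + 2) ≤ (1 + p) * (z ^ (k + 1) - p ^ (k + 1)) := by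
    intro k
    have e1 : p ^ k * (z - p) ≤ z ^ (k + 1) - p ^ (k + 1) := by
      have := pow_le_pow_left₀ hp0.le hz k
      nlinarith [mul_le_mul_of_nonneg_right this hz0, pow_succ z k, pow_succ p k]
    have e2 : 0 ≤ z ^ (k + 1) - p ^ (k + 1) := sub_nonneg.2 (pow_le_pow_left₀ hp0.le hz _)
    have e3 : z ^ (k + 2) - p ^ (k + 2) =
      z * (z ^ (k + 1) - p ^ (k + 1)) + p * (p ^ k * (z - p)) := by ring
    rw [e3]
    nlinarith
  have hratio : ∀ k : ℕ, phiCoeff p (k + 2) * (z ^ (k + 2) - p ^ (k + 2)) ≤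
      49 / 50 * (phiCoeff p (k + 1) * (z ^ (k + 1) - p ^ (k + 1))) := by
    intro k
    have hb := phiCoeff_pos hp0 hp1 (k + 1)
    have e2 : 0 ≤ z ^ (k + 1) - p ^ (k + 1) := sub_nonneg.2 (pow_le_pow_left₀ hp0.le hz _)
    calc phiCoeff p (k + 2) * (z ^ (k + 2) - p ^ (k + 2))
        ≤ phiCoeff p (k + 2) * ((1 + p) * (z ^ (k + 1) - p ^ (k + 1))) :=
          mul_le_mul_of_nonneg_left (hstep k) (phiCoeff_pos hp0 hp1 (k + 2)).le
      _ = p ^ (k + 1) * (1 + p) / (1 - p ^ (k + 2)) ^ 2 *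
          (phiCoeff p (k + 1) * (z ^ (k + 1) - p ^ (k + 1))) := by
          rw [phiCoeff_succ p (k + 1)]; ring
      _ ≤ _ := mul_le_mul_of_nonneg_right (phiCoeff_ratio_le h1 h2 k) (by positivity)
  have hanti : Antitone fun k : ℕ => phiCoeff p (k + 1) * (z ^ (k + 1) - p ^ (k + 1)) := by
    refine antitone_nat_of_succ_le fun k => (hratio k).trans ?_
    have hb := phiCoeff_pos hp0 hp1 (k + 1)
    have e2 : 0 ≤ z ^ (k + 1) - p ^ (k + 1) := sub_nonneg.2 (pow_le_pow_left₀ hp0.le hz _)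
    have : 0 ≤ phiCoeff p (k + 1) * (z ^ (k + 1) - p ^ (k + 1)) := by positivity
    linarith
  have h := hanti.alternating_series_le_tendsto hsum.tendsto_sum_nat 1
  have h0 := hratio 0
  have hc : 1 ≤ phiCoeff p 1 := by
    have : 0 < 1 - p := by linarith
    simp only [phiCoeff, Finset.prod_range_one, pow_zero, zero_add, pow_one]
    rw [one_le_div (by positivity)]
    nlinarith
  simp only [mul_one, Finset.sum_range_succ, Finset.sum_range_zero, pow_zero, one_mul,
    zero_add, pow_one] at h h0
  have : z - p ≤ phiCoeff p 1 * (z - p) := le_mul_of_one_le_left (by linarith) hc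
  norm_num at h h0
  linarith

lemma exists_phiFun_neg {v : ℝ} (hv1 : -1 < v) (hv0 : v < 0) :
    ∃ p : ℝ, 0 < p ∧ p < 1 ∧ 0 < phiFun p p ∧ phiFun p (p ^ (v + 1)) < 0 := by
  have e0 : 1 < (11 / 25 : ℝ) ^ v :=
    Real.one_lt_rpow_of_pos_of_lt_one_of_neg (by norm_num) (by norm_num) hv0
  obtain ⟨δ, hδ⟩ : ∃ δ : ℝ, δ = 21 / 50 * ((11 / 25 : ℝ) ^ v - 1) / 50 := ⟨_, rfl⟩
  have hδ0 : 0 < δ := by linarith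
  have hm : 0 < min δ (phiFun (21 / 50) (21 / 50)) := lt_min hδ0 phiFun_left_pos
  obtain ⟨ε, hε0, hε⟩ := exists_between hm
  have hεδ : ε < δ := hε.trans_le (min_le_left _ _)
  have hεφ : ε < phiFun (21 / 50) (21 / 50) := hε.trans_le (min_le_right _ _)
  obtain ⟨p, ⟨h1, h2⟩, hp⟩ := intermediate_value_Icc' (by norm_num) continuousOn_phiFun_diag
    ⟨(phiFun_right_neg.trans hε0).le, hεφ.le⟩
  simp only at hp
  have hp0 : 0 < p := by linarith
  have hp1 : p < 1 := by linarith
  refine ⟨p, hp0, hp1, hp ▸ hε0, ?_⟩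
  have e1 : (11 / 25 : ℝ) ^ v ≤ p ^ v := Real.rpow_le_rpow_of_nonpos hp0 h2 hv0.le
  have e2 : p ^ (v + 1) = p ^ v * p := by rw [Real.rpow_add hp0, Real.rpow_one]
  have e3 : 1 < p ^ v := Real.one_lt_rpow_of_pos_of_lt_one_of_neg hp0 hp1 hv0
  have e4 : p ^ (v + 1) ≤ 1 := Real.rpow_le_one hp0.le hp1.le (by linarith)
  have e5 : p ≤ p ^ (v + 1) := by rw [e2]; nlinarith
  have e6 := phiFun_sub_ge h1 h2 e5 e4
  have e7 : 21 / 50 * ((11 / 25 : ℝ) ^ v - 1) ≤ p * (p ^ v - 1) :=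
    mul_le_mul h1 (by linarith) (by linarith) hp0.le
  rw [hp, e2] at e6
  rw [e2]
  linarith

end Oscillation

section Positivity

variable {q v : ℝ}

lemma qPochInf_ne_zero {p z : ℝ} (hp0 : 0 < p) (hp1 : p < 1) (hz : 0 ≤ z) (hz1 : z < 1) :
    qPochInf z p ≠ 0 := by
  have hs : Summable fun i : ℕ => ‖-(z * p ^ i)‖ := by
    simp only [norm_neg, norm_mul, norm_pow, Real.norm_of_nonneg hz, Real.norm_of_nonneg hp0.le]
    exact (summable_geometric_of_lt_one hp0.le hp1).mul_left z
  have h := tprod_one_add_ne_zero_of_summable (f := fun i : ℕ => -(z * p ^ i)) (fun i => ?_) hs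
  · simpa only [qPochInf, sub_eq_add_neg] using h
  · have : z * p ^ i < 1 :=
      (mul_le_of_le_one_right hz (pow_le_one₀ hp0.le hp1.le)).trans_lt hz1
    rw [← sub_eq_add_neg]
    exact (sub_pos.2 this).ne'

lemma cqv_ne_zero (hq0 : 0 < q) (hq1 : q < 1) (hv : -1 < v) : cqv q v ≠ 0 := by
  have hp0 : 0 < q ^ 2 := by positivity
  have hp1 : q ^ 2 < 1 := pow_lt_one₀ hq0.le hq1 two_ne_zero
  have ha1 : q ^ (2 * v + 2) < 1 := Real.rpow_lt_one hq0.le hq1 (by linarith)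
  exact div_ne_zero (mul_ne_zero (one_div_ne_zero (sub_pos.2 hq1).ne')
    (qPochInf_ne_zero hp0 hp1 (by positivity) ha1)) (qPochInf_ne_zero hp0 hp1 hp0.le hp1)

lemma zpow_mul_rpow_eq (hq0 : 0 < q) (v : ℝ) (n : ℤ) :
    q ^ n * (q ^ n) ^ (2 * v + 1 : ℝ) = (q ^ (2 * v + 2 : ℝ)) ^ n := by
  rw [← Real.rpow_intCast q n, ← Real.rpow_intCast _ n, ← Real.rpow_mul hq0.le,
    ← Real.rpow_mul hq0.le, ← Real.rpow_add hq0]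
  ring_nf

/-- A function on the lattice whose transform is a multiple of the order zero Bessel function. -/
def sonineFun (q a : ℝ) : ℝ → ℝ :=
  Function.extend (fun n : ℤ => q ^ n)
    (fun n => if n < 0 then 0 else sonineWeight (q ^ 2) a n.toNat / a ^ n) 0

lemma sonineFun_zpow (hq0 : 0 < q) (hq1 : q < 1) (a : ℝ) (n : ℤ) :
    sonineFun q a (q ^ n) = if n < 0 then 0 else sonineWeight (q ^ 2) a n.toNat / a ^ n :=
  (zpow_right_injective₀ hq0 hq1.ne).extend_apply _ _ n

lemma sonineFun_zpow_of_neg (hq0 : 0 < q) (hq1 : q < 1) (a : ℝ) {n : ℤ} (hn : n < 0) :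
    sonineFun q a (q ^ n) = 0 := by
  rw [sonineFun_zpow hq0 hq1, if_pos hn]

lemma sonineFun_zpow_natCast_mul (hq0 : 0 < q) (hq1 : q < 1) {a : ℝ} (ha : 0 < a) (k : ℕ) :
    a ^ (k : ℤ) * sonineFun q a (q ^ (k : ℤ)) = sonineWeight (q ^ 2) a k := by
  rw [sonineFun_zpow hq0 hq1, if_neg (by omega), Int.toNat_natCast,
    mul_div_cancel₀ _ (zpow_ne_zero _ ha.ne')]

lemma sonineFun_nonneg {a : ℝ} (hq0 : 0 < q) (hq1 : q < 1) (hqa : q ^ 2 < a) (ha1 : a < 1)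
    (n : ℤ) : 0 ≤ sonineFun q a (q ^ n) := by
  have hp0 : 0 < q ^ 2 := by positivity
  have ha0 := hp0.trans hqa
  rw [sonineFun_zpow hq0 hq1]
  split_ifs
  · exact le_rfl
  · exact div_nonneg (sonineWeight_nonneg hp0 hqa ha1 _) (by positivity)

lemma memL1_sonineFun (hq0 : 0 < q) (hq1 : q < 1) (hqa : q ^ 2 < q ^ (2 * v + 2))
    (ha1 : q ^ (2 * v + 2) < 1) : memL1 q v (sonineFun q (q ^ (2 * v + 2))) := by
  have hp0 : 0 < q ^ 2 := by positivity
  rw [memL1, summable_int_iff_summable_nat fun m hm => by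
    rw [sonineFun_zpow_of_neg hq0 hq1 _ hm]; simp]
  refine (summable_sonineWeight hp0 hqa ha1).congr fun k => ?_
  rw [abs_of_nonneg (sonineFun_nonneg hq0 hq1 hqa ha1 _), mul_right_comm,
    zpow_mul_rpow_eq hq0, sonineFun_zpow_natCast_mul hq0 hq1 (hp0.trans hqa)]

lemma qFourier_sonineFun (hq0 : 0 < q) (hq1 : q < 1) (hv : -1 < v)
    (hqa : q ^ 2 < q ^ (2 * v + 2)) (n : ℤ) :
    qFourier q v (sonineFun q (q ^ (2 * v + 2))) (q ^ n) =
      cqv q v * (1 - q) * ((∑' m : ℕ, sonineWeight (q ^ 2) (q ^ (2 * v + 2)) m) /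
        eulerFun (q ^ 2) (q ^ 2)) * besselLattice (q ^ 2) (q ^ 2) n := by
  have hp0 : 0 < q ^ 2 := by positivity
  have ha0 := hp0.trans hqa
  have ha1 : q ^ (2 * v + 2) < 1 := Real.rpow_lt_one hq0.le hq1 (by linarith)
  have hE := (eulerFun_pos hp0 (hqa.trans ha1) ha0.le ha1).ne'
  have key : eulerFun (q ^ 2) (q ^ (2 * v + 2)) * ∑' k : ℤ, q ^ k *
      (sonineFun q (q ^ (2 * v + 2)) (q ^ k) * jHE q v (q ^ n * q ^ k) *
        (q ^ k) ^ (2 * v + 1 : ℝ)) =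
      (∑' m : ℕ, sonineWeight (q ^ 2) (q ^ (2 * v + 2)) m) * eulerFun (q ^ 2) (q ^ (2 * v + 2)) /
        eulerFun (q ^ 2) (q ^ 2) * besselLattice (q ^ 2) (q ^ 2) n := by
    rw [← tsum_sonineWeight_mul_besselLattice hp0 hqa ha1, tsum_int_eq_tsum_nat fun m hm => by
      rw [sonineFun_zpow_of_neg hq0 hq1 _ hm]; simp, ← tsum_mul_left]
    refine tsum_congr fun k => ?_
    rw [← eulerFun_mul_jHE hq0 hq1 hv, zpow_add₀ hq0.ne',
      ← sonineFun_zpow_natCast_mul hq0 hq1 ha0 k, ← zpow_mul_rpow_eq hq0]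
    ring
  rw [qFourier, jackson]
  refine mul_left_cancel₀ hE ?_
  linear_combination cqv q v * (1 - q) * key

lemma qTrans_sonineFun (hq0 : 0 < q) (hq1 : q < 1) (hv : -1 < v)
    (hqa : q ^ 2 < q ^ (2 * v + 2)) :
    eulerFun (q ^ 2) (q ^ (2 * v + 2)) ^ 2 *
        qTrans q v 1 (sonineFun q (q ^ (2 * v + 2))) 1 =
      (cqv q v * (1 - q)) ^ 2 * ((∑' m : ℕ, sonineWeight (q ^ 2) (q ^ (2 * v + 2)) m) /
        eulerFun (q ^ 2) (q ^ 2)) * (eulerTheta (q ^ 2) 0 *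
          (besselLattice (q ^ 2) (q ^ (2 * v + 2)) 0 * besselLattice (q ^ 2) (q ^ 2) 0)) := by
  have hp0 : 0 < q ^ 2 := by positivity
  have ha0 := hp0.trans hqa
  have ha1 : q ^ (2 * v + 2) < 1 := Real.rpow_lt_one hq0.le hq1 (by linarith)
  rw [← tsum_besselLattice_triple hp0 (hqa.trans ha1) ha0 ha1, qTrans, jackson,
    ← mul_assoc, ← mul_assoc, ← tsum_mul_left, ← tsum_mul_left]
  refine tsum_congr fun n => ?_
  rw [one_mul, qFourier_sonineFun hq0 hq1 hv hqa, ← eulerFun_mul_jHE hq0 hq1 hv,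
    ← zpow_mul_rpow_eq hq0]
  ring

lemma exists_not_isPosT {v : ℝ} (hv1 : -1 < v) (hv0 : v < 0) :
    ∃ q : ℝ, 0 < q ∧ q < 1 ∧ ¬ IsPosT q v 1 := by
  obtain ⟨p, hp0, hp1, h1, h2⟩ := exists_phiFun_neg hv1 hv0
  obtain ⟨q, hq0, hq1, rfl⟩ : ∃ q : ℝ, 0 < q ∧ q < 1 ∧ q ^ 2 = p :=
    ⟨√p, Real.sqrt_pos.2 hp0, (Real.sqrt_lt' one_pos).2 (by simpa using hp1), Real.sq_sqrt hp0.le⟩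
  refine ⟨q, hq0, hq1, fun h => ?_⟩
  have e : (q ^ 2) ^ (v + 1) = q ^ (2 * v + 2) := by
    rw [← Real.rpow_natCast, ← Real.rpow_mul hq0.le]; push_cast; ring_nf
  rw [e] at h2
  have ha1 : q ^ (2 * v + 2) < 1 := Real.rpow_lt_one hq0.le hq1 (by linarith)
  have hqa : q ^ 2 < q ^ (2 * v + 2) := by
    rw [← Real.rpow_natCast]
    exact Real.rpow_lt_rpow_of_exponent_gt hq0 hq1 (by push_cast; linarith)
  have hpos := h _ (memL1_sonineFun hq0 hq1 hqa ha1)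
    (by rintro _ ⟨n, rfl⟩; exact sonineFun_nonneg hq0 hq1 hqa ha1 n) 1 ⟨0, by simp⟩
  have hE := eulerFun_pos hp0 hp1 hp0.le hp1
  have hS : 0 < ∑' m : ℕ, sonineWeight (q ^ 2) (q ^ (2 * v + 2)) m :=
    (summable_sonineWeight hp0 hqa ha1).tsum_pos (sonineWeight_nonneg hp0 hqa ha1) 0
      (by simp [sonineWeight])
  have hc : 0 < (cqv q v * (1 - q)) ^ 2 :=
    sq_pos_of_ne_zero (mul_ne_zero (cqv_ne_zero hq0 hq1 hv1) (sub_pos.2 hq1).ne')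
  have hT : 0 < eulerTheta (q ^ 2) 0 := by simpa [eulerTheta] using hE
  have key := qTrans_sonineFun hq0 hq1 hv1 hqa
  have hneg : besselLattice (q ^ 2) (q ^ (2 * v + 2)) 0 * besselLattice (q ^ 2) (q ^ 2) 0 < 0 := by
    rw [besselLattice_zero hp0 hp1, besselLattice_zero hp0 hp1]
    exact mul_neg_of_neg_of_pos (mul_neg_of_pos_of_neg hE h2) (mul_pos hE h1)
  have hneg' := mul_neg_of_pos_of_neg (mul_pos hc (div_pos hS hE))
    (mul_neg_of_pos_of_neg hT hneg)
  rw [← key] at hneg'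
  exact hneg'.not_ge (mul_nonneg (sq_nonneg _) hpos)

end Positivity

/-- for `-1 < v < 0` the positivity domain `Q_v` is a proper subset of
`(0,1)`. -/
theorem stmt14 (v : ℝ) (hv1 : -1 < v) (hv0 : v < 0) :
    Qset v ⊂ Set.Ioo (0 : ℝ) 1 := by
  obtain ⟨q, hq0, hq1, hq⟩ := exists_not_isPosT hv1 hv0
  exact ⟨fun _ h => h.1, fun h => hq ((h ⟨hq0, hq1⟩).2 1 ⟨0, by simp⟩)⟩
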